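/- arXiv:1509.03324 — 6 statements merged into one kernel-verified Lean document; each statement's English description precedes it below -/
import Mathlib

section
/- For every integer n ≥ 2, the function ψ is strictly increasing on the open interval (-1,1): if -1 < τ₁ < τ₂ < 1 then ψ(τ₁) < ψ(τ₂). -/
open MeasureTheory Real

/-- `omegaBall k` is the Lebesgue measure of the unit ball of `ℝ^k`. -/
noncomputable def omegaBall (k : ℕ) : ℝ :=
  (volume (Metric.ball (0 : EuclideanSpace ℝ (Fin k)) 1)).toReal

/-- `capV n τ = ∫_{-τ}^1 ω_{n-1} (1-ρ²)^{(n-1)/2} dρ`, the volume of the spherical cap. -/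
noncomputable def capV (n : ℕ) (τ : ℝ) : ℝ :=
  ∫ ρ in (-τ)..1, omegaBall (n - 1) * (1 - ρ ^ 2) ^ (((n : ℝ) - 1) / 2)

/-- `capA n τ = ∫_{-τ}^1 (n-1) ω_{n-1} (1-ρ²)^{(n-3)/2} dρ`, the spherical area of the cap. -/
noncomputable def capA (n : ℕ) (τ : ℝ) : ℝ :=
  ∫ ρ in (-τ)..1, ((n : ℝ) - 1) * omegaBall (n - 1) * (1 - ρ ^ 2) ^ (((n : ℝ) - 3) / 2)

/-- `capA0 n τ = ω_{n-1} (1-τ²)^{(n-1)/2}`, the area of the flat face of the cap. -/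
noncomputable def capA0 (n : ℕ) (τ : ℝ) : ℝ :=
  omegaBall (n - 1) * (1 - τ ^ 2) ^ (((n : ℝ) - 1) / 2)

/-- `psiFun n τ = (A(τ) + τ A₀(τ)) / V(τ)^{(n-1)/n}`, the normalized capillarity energy. -/
noncomputable def psiFun (n : ℕ) (τ : ℝ) : ℝ :=
  (capA n τ + τ * capA0 n τ) / (capV n τ) ^ (((n : ℝ) - 1) / (n : ℝ))


theorem omegaBall_pos_aux (k : ℕ) : 0 < omegaBall k := by
  unfold omegaBall
  exact ENNReal.toReal_pos (Metric.measure_ball_pos volume _ one_pos).ne'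
    (measure_ball_lt_top).ne

theorem cap_integrable_aux (q t : ℝ) (hq : -1 < q) (h1 : -1 < t) (h2 : t < 1) :
    IntervalIntegrable (fun ρ : ℝ => (1 - ρ ^ 2) ^ q) volume (-t) 1 := by
  have hA : IntervalIntegrable (fun ρ : ℝ => (1 - ρ) ^ q) volume (-t) 1 := by
    have h := (intervalIntegral.intervalIntegrable_rpow' (a := 1 + t) (b := 0) hq).comp_sub_left 1
    simpa using h
  have hB : ContinuousOn (fun ρ : ℝ => (1 + ρ) ^ q) (Set.uIcc (-t) 1) := by
    rw [Set.uIcc_of_le (by linarith)]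
    intro x hx
    refine ContinuousAt.continuousWithinAt (ContinuousAt.rpow_const (by fun_prop) (Or.inl ?_))
    have := hx.1
    linarith
  refine (hA.mul_continuousOn hB).congr ?_
  intro x hx
  rw [Set.uIoc_of_le (by linarith)] at hx
  have h3 := hx.1
  have h4 := hx.2
  simp only
  rw [← Real.mul_rpow (by linarith) (by linarith)]
  congr 1
  ring

theorem cap_identity_aux (m t : ℝ) (hm : 1 < m) (h1 : -1 < t) (h2 : t < 1) :
    (∫ ρ in (-t)..1, (m - 1) * (1 - ρ ^ 2) ^ ((m - 3) / 2)) + t * (1 - t ^ 2) ^ ((m - 1) / 2)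
      = m * ∫ ρ in (-t)..1, (1 - ρ ^ 2) ^ ((m - 1) / 2) := by
  have i1 := (cap_integrable_aux ((m - 3) / 2) t (by linarith) h1 h2).const_mul (m - 1)
  have i2 := (cap_integrable_aux ((m - 1) / 2) t (by linarith) h1 h2).const_mul m
  have key := intervalIntegral.integral_eq_sub_of_hasDerivAt_of_le
    (f := fun ρ : ℝ => -ρ * (1 - ρ ^ 2) ^ ((m - 1) / 2))
    (f' := fun ρ : ℝ => (m - 1) * (1 - ρ ^ 2) ^ ((m - 3) / 2) - m * (1 - ρ ^ 2) ^ ((m - 1) / 2))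
    (a := -t) (b := 1) (by linarith) ?_ ?_ (i1.sub i2)
  · rw [intervalIntegral.integral_sub i1 i2, intervalIntegral.integral_const_mul m] at key
    have hz : (0 : ℝ) ^ ((m - 1) / 2) = 0 := Real.zero_rpow (by linarith)
    norm_num [hz] at key
    rw [intervalIntegral.integral_const_mul]
    linarith
  · refine Continuous.continuousOn ?_
    refine Continuous.mul (by fun_prop) (Continuous.rpow_const (by fun_prop) ?_)
    intro x
    right
    linarith
  · intro x hx
    have hp : 0 < 1 - x ^ 2 := by nlinarith [hx.1, hx.2]
    have hd : HasDerivAt (fun ρ : ℝ => 1 - ρ ^ 2) (-(2 * x)) x := by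
      simpa using (hasDerivAt_pow 2 x).const_sub 1
    have h := (hasDerivAt_id x).neg.mul (hd.rpow_const (p := (m - 1) / 2) (Or.inl hp.ne'))
    refine h.congr_deriv ?_
    have e : (1 - x ^ 2) ^ ((m - 1) / 2) = (1 - x ^ 2) ^ ((m - 3) / 2) * (1 - x ^ 2) := by
      rw [← Real.rpow_add_one hp.ne']
      congr 1
      ring
    have e2 : (m - 1) / 2 - 1 = (m - 3) / 2 := by ring
    simp only [e2, Pi.neg_apply, id]
    rw [e]
    ring

theorem psi_eq_aux (n : ℕ) (hn : 2 ≤ n) (t : ℝ) (h1 : -1 < t) (h2 : t < 1) :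
    0 < capV n t ∧ psiFun n t = n * (capV n t) ^ ((1 : ℝ) / n) := by
  have hw := omegaBall_pos_aux (n - 1)
  have hm : (2 : ℝ) ≤ n := by exact_mod_cast hn
  have hV : 0 < capV n t := by
    unfold capV
    refine intervalIntegral.intervalIntegral_pos_of_pos_on
      ((cap_integrable_aux _ t (by linarith) h1 h2).const_mul _) ?_ (by linarith)
    intro x hx
    have hp : 0 < 1 - x ^ 2 := by nlinarith [hx.1, hx.2]
    positivity
  refine ⟨hV, ?_⟩
  have hid : capA n t + t * capA0 n t = n * capV n t := by
    have h := cap_identity_aux n t (by linarith) h1 h2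
    unfold capA capA0 capV
    rw [intervalIntegral.integral_const_mul] at h ⊢
    rw [intervalIntegral.integral_const_mul]
    linear_combination omegaBall (n - 1) * h
  unfold psiFun
  rw [hid, mul_div_assoc]
  congr 1
  rw [div_eq_iff (by positivity), ← Real.rpow_add hV]
  have : (1 : ℝ) / n + ((n : ℝ) - 1) / n = 1 := by
    field_simp
    ring
  rw [this, Real.rpow_one]

/-- For every `n ≥ 2`, the function `ψ` is strictly increasing on `(-1,1)`. -/
theorem psi_strictMono_on (n : ℕ) (hn : 2 ≤ n) :
    ∀ τ₁ τ₂ : ℝ, -1 < τ₁ → τ₁ < τ₂ → τ₂ < 1 → psiFun n τ₁ < psiFun n τ₂ := by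
  intro a b ha hab hb
  have hw := omegaBall_pos_aux (n - 1)
  have hm : (2 : ℝ) ≤ n := by exact_mod_cast hn
  obtain ⟨pa, ea⟩ := psi_eq_aux n hn a ha (by linarith)
  obtain ⟨pb, eb⟩ := psi_eq_aux n hn b (by linarith) hb
  rw [ea, eb]
  have ia := (cap_integrable_aux (((n : ℝ) - 1) / 2) a (by linarith) ha
    (by linarith)).const_mul (omegaBall (n - 1))
  have ib := (cap_integrable_aux (((n : ℝ) - 1) / 2) b (by linarith) (by linarith)
    hb).const_mul (omegaBall (n - 1))
  have iab := ib.trans ia.symm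
  have hlt : capV n a < capV n b := by
    unfold capV
    rw [← intervalIntegral.integral_add_adjacent_intervals iab ia]
    have : 0 < ∫ ρ in (-b)..(-a), omegaBall (n - 1) * (1 - ρ ^ 2) ^ (((n : ℝ) - 1) / 2) := by
      refine intervalIntegral.intervalIntegral_pos_of_pos_on iab ?_ (by linarith)
      intro x hx
      have hp : 0 < 1 - x ^ 2 := by nlinarith [hx.1, hx.2]
      positivity
    linarith
  have := Real.rpow_lt_rpow pa.le hlt (z := (1 : ℝ) / n) (by positivity)
  exact mul_lt_mul_of_pos_left this (by linarith)
end

section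
/- For every integer n ≥ 2 and every τ ∈ (-1,1), one has the identity n²·V(τ) − (n−1)·(A(τ) + τ·A₀(τ)) = n·( ω_n/2 + ∫₀^{τ} ω_{n-1}(1−s²)^{(n-1)/2} ds ), and this quantity is strictly positive. -/
open MeasureTheory Real

lemma cap_cont (p : ℝ) (hp : 0 ≤ p) : Continuous (fun x : ℝ => (1 - x ^ 2) ^ p) :=
  Continuous.rpow_const (by fun_prop) (fun _ => Or.inr hp)

lemma cap_rec (p : ℝ) (hp : 0 < p) (a : ℝ) (ha : a ∈ Set.Ioo (-1 : ℝ) 1) :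
    (2 * p + 1) * ∫ x in a..1, (1 - x ^ 2 : ℝ) ^ p =
      2 * p * (∫ x in a..1, (1 - x ^ 2 : ℝ) ^ (p - 1)) - a * (1 - a ^ 2) ^ p := by
  obtain ⟨h1, h2⟩ := ha
  have hc := cap_cont p hp.le
  set G : ℝ → ℝ := fun x => (2 * p + 1) * (∫ t in a..x, (1 - t ^ 2 : ℝ) ^ p) - x * (1 - x ^ 2) ^ p with hG
  have hd0 : ∀ x : ℝ, HasDerivAt (fun x => ∫ t in a..x, (1 - t ^ 2 : ℝ) ^ p) ((1 - x ^ 2) ^ p) x :=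
    fun x => hc.integral_hasStrictDerivAt a x |>.hasDerivAt
  have hcont : ContinuousOn G (Set.Icc a 1) := by
    apply Continuous.continuousOn
    have : Continuous (fun x => ∫ t in a..x, (1 - t ^ 2 : ℝ) ^ p) :=
      continuous_iff_continuousAt.2 fun x => (hd0 x).continuousAt
    exact (continuous_const.mul this).sub (continuous_id.mul hc)
  have hpos : ∀ x ∈ Set.Ioo a 1, 0 < 1 - x ^ 2 := by
    intro x hx
    have := hx.1; have := hx.2
    nlinarith
  have hder : ∀ x ∈ Set.Ioo a 1, HasDerivAt G (2 * p * (1 - x ^ 2) ^ (p - 1)) x := by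
    intro x hx
    have hx0 := hpos x hx
    have hb : HasDerivAt (fun x : ℝ => 1 - x ^ 2) (-(2 * x)) x := by
      simpa using (hasDerivAt_pow 2 x).const_sub 1
    have h3 := hb.rpow_const (p := p) (Or.inl hx0.ne')
    have h4 := ((hd0 x).const_mul (2 * p + 1)).sub ((hasDerivAt_id x).mul h3)
    refine h4.congr_deriv ?_
    have : (1 - x ^ 2) ^ p = (1 - x ^ 2) ^ (p - 1) * (1 - x ^ 2) := by
      rw [← Real.rpow_add_one hx0.ne']; simp
    simp only [id]
    rw [this]; ring
  have hnn : ∀ x ∈ Set.Ioo a 1, 0 ≤ 2 * p * (1 - x ^ 2) ^ (p - 1) := by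
    intro x hx
    have := hpos x hx
    positivity
  have hint : IntervalIntegrable (fun x : ℝ => 2 * p * (1 - x ^ 2) ^ (p - 1)) volume a 1 := by
    rw [intervalIntegrable_iff_integrableOn_Ioc_of_le h2.le]
    exact intervalIntegral.integrableOn_deriv_of_nonneg hcont hder hnn
  have := intervalIntegral.integral_eq_sub_of_hasDerivAt_of_le h2.le hcont hder hint
  rw [intervalIntegral.integral_const_mul] at this
  rw [this]
  simp [hG, Real.zero_rpow hp.ne']

lemma cap_half (n : ℕ) : ∫ x in (0:ℝ)..1, (1 - x ^ 2 : ℝ) ^ ((n : ℝ) / 2) =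
    √π / 2 * Real.Gamma ((n : ℝ) / 2 + 1) / Real.Gamma ((n : ℝ) / 2 + 3 / 2) := by
  have hs : 0 < √π := by positivity
  have g32 : Real.Gamma (3 / 2) = √π / 2 := by
    have := Real.Gamma_add_one (s := 1 / 2) (by norm_num)
    rw [Real.Gamma_one_half_eq] at this
    rw [← show (1 / 2 + 1 : ℝ) = 3 / 2 by norm_num, this]; ring
  induction n using Nat.twoStepInduction with
  | zero => simp [g32]; field_simp
  | one =>
    have h := integral_sqrt_one_sub_sq
    have hc : Continuous (fun x : ℝ => √(1 - x ^ 2)) := by fun_prop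
    rw [← intervalIntegral.integral_add_adjacent_intervals (hc.intervalIntegrable _ 0)
      (hc.intervalIntegrable _ _)] at h
    have h' : ∫ x in (-1:ℝ)..0, √(1 - x ^ 2) = ∫ x in (0:ℝ)..1, √(1 - x ^ 2) := by
      have := intervalIntegral.integral_comp_neg (a := 0) (b := 1) (fun x : ℝ => √(1 - x ^ 2))
      simpa using this.symm
    rw [h'] at h
    have e : ∫ x in (0:ℝ)..1, (1 - x ^ 2 : ℝ) ^ (((1:ℕ) : ℝ) / 2) = ∫ x in (0:ℝ)..1, √(1 - x ^ 2) := by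
      simp [Real.sqrt_eq_rpow]
    rw [e]
    rw [show (((1:ℕ):ℝ) / 2 + 1) = 3 / 2 by norm_num, show (((1:ℕ):ℝ) / 2 + 3 / 2) = 1 + 1 by norm_num,
      g32, Real.Gamma_add_one one_ne_zero, Real.Gamma_one]
    have := Real.mul_self_sqrt pi_pos.le
    linarith
  | more n ih _ =>
    have h := cap_rec ((n : ℝ) / 2 + 1) (by positivity) 0 (by simp)
    have e1 : (((n + 2 : ℕ) : ℝ) / 2) = (n : ℝ) / 2 + 1 := by push_cast; ring
    rw [e1]
    rw [add_sub_cancel_right, ih] at h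
    have h1 := Real.Gamma_add_one (s := (n : ℝ) / 2 + 1) (by positivity)
    have h2 := Real.Gamma_add_one (s := (n : ℝ) / 2 + 3 / 2) (by positivity)
    rw [h1, show (n : ℝ) / 2 + 1 + 3 / 2 = (n : ℝ) / 2 + 3 / 2 + 1 by ring, h2]
    have hg : 0 < Real.Gamma ((n : ℝ) / 2 + 3 / 2) := Real.Gamma_pos_of_pos (by positivity)
    have h0 : (2 * ((n : ℝ) / 2 + 1) + 1) ≠ 0 := by positivity
    apply mul_left_cancel₀ h0
    rw [h]
    field_simp
    ring

lemma omegaBall_formula (k : ℕ) (hk : 1 ≤ k) :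
    omegaBall k = √π ^ k / Real.Gamma ((k : ℝ) / 2 + 1) := by
  have : Nonempty (Fin k) := ⟨⟨0, hk⟩⟩
  have hg : 0 < Real.Gamma ((k : ℝ) / 2 + 1) := Real.Gamma_pos_of_pos (by positivity)
  rw [omegaBall, EuclideanSpace.volume_ball]
  simp
  positivity

lemma omegaBall_succ (k : ℕ) (hk : 1 ≤ k) :
    omegaBall (k + 1) / 2 = omegaBall k * ∫ x in (0:ℝ)..1, (1 - x ^ 2 : ℝ) ^ ((k : ℝ) / 2) := by
  rw [cap_half, omegaBall_formula k hk, omegaBall_formula (k + 1) (by omega)]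
  have hg : 0 < Real.Gamma ((k : ℝ) / 2 + 1) := Real.Gamma_pos_of_pos (by positivity)
  rw [show ((k + 1 : ℕ) : ℝ) / 2 + 1 = (k : ℝ) / 2 + 3 / 2 by push_cast; ring]
  field_simp
  ring

/-- For every `n ≥ 2` and `τ ∈ (-1,1)`:
`n²V(τ) − (n−1)(A(τ)+τA₀(τ)) = n(ωₙ/2 + ∫₀^τ ω_{n-1}(1−s²)^{(n-1)/2} ds)`,
and this quantity is strictly positive. -/
theorem varphi_formula_pos (n : ℕ) (hn : 2 ≤ n) (τ : ℝ) (hτ : τ ∈ Set.Ioo (-1 : ℝ) 1) :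
    (n : ℝ) ^ 2 * capV n τ - ((n : ℝ) - 1) * (capA n τ + τ * capA0 n τ) =
      (n : ℝ) * (omegaBall n / 2 + ∫ s in (0 : ℝ)..τ, omegaBall (n - 1) * (1 - s ^ 2) ^ (((n : ℝ) - 1) / 2)) ∧
    0 < (n : ℝ) ^ 2 * capV n τ - ((n : ℝ) - 1) * (capA n τ + τ * capA0 n τ) := by
  obtain ⟨k, rfl⟩ : ∃ k, n = k + 1 := ⟨n - 1, by omega⟩
  have hk : 1 ≤ k := by omega
  have hk0 : (0 : ℝ) < k := by exact_mod_cast hk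
  obtain ⟨h1, h2⟩ := hτ
  have hc := cap_cont ((k : ℝ) / 2) (by positivity)
  have hw : 0 < omegaBall k := by
    rw [omegaBall_formula k hk]
    have hg : 0 < Real.Gamma ((k : ℝ) / 2 + 1) := Real.Gamma_pos_of_pos (by positivity)
    positivity
  have e2 : (((k + 1 : ℕ) : ℝ) - 1) = k := by push_cast; ring
  have e3 : (((k + 1 : ℕ) : ℝ) - 3) / 2 = (k : ℝ) / 2 - 1 := by push_cast; ring
  have hrec := cap_rec ((k : ℝ) / 2) (by positivity) (-τ) ⟨by linarith, by linarith⟩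
  have hsym : ∫ x in (-τ)..0, (1 - x ^ 2 : ℝ) ^ ((k : ℝ) / 2) =
      ∫ x in (0:ℝ)..τ, (1 - x ^ 2 : ℝ) ^ ((k : ℝ) / 2) := by
    have := intervalIntegral.integral_comp_neg (a := 0) (b := τ)
      (fun x : ℝ => (1 - x ^ 2 : ℝ) ^ ((k : ℝ) / 2))
    simpa using this.symm
  have hadd := intervalIntegral.integral_add_adjacent_intervals (μ := volume)
    (hc.intervalIntegrable (-τ) 0) (hc.intervalIntegrable 0 1)
  have hpos : 0 < ∫ x in (-τ)..1, (1 - x ^ 2 : ℝ) ^ ((k : ℝ) / 2) := by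
    apply intervalIntegral.intervalIntegral_pos_of_pos_on (hc.intervalIntegrable _ _) _ (by linarith)
    intro x hx
    have := hx.1; have := hx.2
    have : 0 < 1 - x ^ 2 := by nlinarith
    positivity
  have hV : capV (k + 1) τ = omegaBall k * ∫ x in (-τ)..1, (1 - x ^ 2 : ℝ) ^ ((k : ℝ) / 2) := by
    rw [capV, intervalIntegral.integral_const_mul, e2, Nat.add_sub_cancel]
  have hS : capA (k + 1) τ + τ * capA0 (k + 1) τ = ((k + 1 : ℕ) : ℝ) * capV (k + 1) τ := by
    rw [hV, capA, capA0, intervalIntegral.integral_const_mul, e3, e2, Nat.add_sub_cancel]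
    rw [neg_sq] at hrec
    push_cast
    linear_combination (-omegaBall k) * hrec
  have hL : ((k + 1 : ℕ) : ℝ) ^ 2 * capV (k + 1) τ
      - (((k + 1 : ℕ) : ℝ) - 1) * (capA (k + 1) τ + τ * capA0 (k + 1) τ)
      = ((k + 1 : ℕ) : ℝ) * capV (k + 1) τ := by
    rw [hS]; ring
  rw [hL]
  constructor
  · rw [intervalIntegral.integral_const_mul, e2, Nat.add_sub_cancel, omegaBall_succ k hk, hV,
      ← hadd, hsym]
    ring
  · rw [hV]; positivity
end

section
/- For every integer n ≥ 2 and every τ ∈ (-1,1), one has A(τ) + τ·A₀(τ) > 0; consequently ψ(τ) > 0. -/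
open MeasureTheory Real

/-- For every `n ≥ 2` and `τ ∈ (-1,1)`, one has `A(τ) + τ·A₀(τ) > 0`;
consequently `ψ(τ) > 0`. -/
theorem capA_add_mul_capA0_pos (n : ℕ) (hn : 2 ≤ n) (τ : ℝ) (hτ : τ ∈ Set.Ioo (-1 : ℝ) 1) :
    0 < capA n τ + τ * capA0 n τ ∧ 0 < psiFun n τ := by
  obtain ⟨h1, h2⟩ := hτ
  have hn2 : (2 : ℝ) ≤ n := by exact_mod_cast hn
  have hw : 0 < omegaBall (n - 1) := by
    unfold omegaBall
    exact ENNReal.toReal_pos (Metric.measure_ball_pos volume _ one_pos).ne'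
      (measure_ball_lt_top).ne
  have hle : -τ ≤ 1 := by linarith
  have ha : (0 : ℝ) ≤ ((n : ℝ) - 1) / 2 := by linarith
  have hcontp : Continuous (fun ρ : ℝ => (1 - ρ ^ 2) ^ (((n : ℝ) - 1) / 2)) :=
    Continuous.rpow_const (by fun_prop) (fun _ => Or.inr ha)
  have hia : IntervalIntegrable (fun ρ : ℝ => (1 - ρ ^ 2) ^ (((n : ℝ) - 1) / 2))
      volume (-τ) 1 := hcontp.intervalIntegrable _ _
  have hib : IntervalIntegrable (fun ρ : ℝ => (1 - ρ ^ 2) ^ (((n : ℝ) - 3) / 2))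
      volume (-τ) 1 := by
    have e1 : IntervalIntegrable (fun ρ : ℝ => (1 - ρ) ^ (((n : ℝ) - 3) / 2))
        volume (-τ) 1 := by
      have := (intervalIntegral.intervalIntegrable_rpow' (a := 1 + τ) (b := 0)
        (r := ((n : ℝ) - 3) / 2) (by linarith)).comp_sub_left 1
      simpa using this
    have e2 : ContinuousOn (fun ρ : ℝ => (1 + ρ) ^ (((n : ℝ) - 3) / 2))
        (Set.uIcc (-τ) 1) := by
      rw [Set.uIcc_of_le hle]
      refine ContinuousOn.rpow_const (by fun_prop) (fun x hx => Or.inl ?_)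
      have := hx.1
      linarith
    refine (e1.mul_continuousOn e2).congr ?_
    intro x hx
    rw [Set.uIoc_of_le hle] at hx
    have := hx.1
    have := hx.2
    show (1 - x) ^ (((n : ℝ) - 3) / 2) * (1 + x) ^ (((n : ℝ) - 3) / 2) = _
    rw [← Real.mul_rpow (by linarith) (by linarith)]
    congr 1
    ring
  have key := intervalIntegral.integral_eq_sub_of_hasDerivAt_of_le hle
    (f := fun ρ : ℝ => ρ * (1 - ρ ^ 2) ^ (((n : ℝ) - 1) / 2))
    (f' := fun ρ : ℝ => (n : ℝ) * (1 - ρ ^ 2) ^ (((n : ℝ) - 1) / 2)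
      - ((n : ℝ) - 1) * (1 - ρ ^ 2) ^ (((n : ℝ) - 3) / 2))
    (by fun_prop)
    (by
      intro x hx
      have hx1 := hx.1
      have hx2 := hx.2
      have hp : 0 < 1 - x ^ 2 := by nlinarith
      have hd : HasDerivAt (fun ρ : ℝ => 1 - ρ ^ 2) (-(2 * x)) x := by
        simpa using ((hasDerivAt_pow 2 x).const_sub 1)
      have := (hasDerivAt_id x).mul
        (hd.rpow_const (p := ((n : ℝ) - 1) / 2) (Or.inl hp.ne'))
      refine this.congr_deriv ?_
      have e : ((n : ℝ) - 1) / 2 - 1 = ((n : ℝ) - 3) / 2 := by ring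
      have e' : (1 - x ^ 2) ^ (((n : ℝ) - 1) / 2)
          = (1 - x ^ 2) ^ (((n : ℝ) - 3) / 2) * (1 - x ^ 2) := by
        rw [← Real.rpow_add_one hp.ne']
        congr 1
        ring
      rw [e, e']
      simp only [id]
      ring)
    ((hia.const_mul _).sub (hib.const_mul _))
  rw [intervalIntegral.integral_sub (hia.const_mul _) (hib.const_mul _),
    intervalIntegral.integral_const_mul, intervalIntegral.integral_const_mul] at key
  have hz : (1 - (1 : ℝ) ^ 2) ^ (((n : ℝ) - 1) / 2) = 0 := by
    rw [one_pow, sub_self, Real.zero_rpow (by linarith)]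
  have hV : 0 < capV n τ := by
    unfold capV
    refine intervalIntegral.intervalIntegral_pos_of_pos_on (hia.const_mul _) ?_ (by linarith)
    intro x hx
    have hx1 := hx.1
    have hx2 := hx.2
    have hp : 0 < 1 - x ^ 2 := by nlinarith
    positivity
  have hmain : capA n τ + τ * capA0 n τ = n * capV n τ := by
    simp only [hz, neg_sq] at key
    unfold capA capA0 capV
    rw [intervalIntegral.integral_const_mul, intervalIntegral.integral_const_mul]
    linear_combination (-omegaBall (n - 1)) * key
  have hpos : 0 < capA n τ + τ * capA0 n τ := by
    rw [hmain]
    exact mul_pos (by linarith) hV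
  exact ⟨hpos, div_pos hpos (Real.rpow_pos_of_pos hV _)⟩
end

section
/- For every integer n ≥ 2 and every τ ∈ (-1,1), one has ψ(τ) ≤ n·ω_n^{1/n}, where ω_n is the Lebesgue measure of the unit ball of ℝⁿ. (The right-hand side is the value ψ(1) corresponding to the isoperimetric problem.) -/
open MeasureTheory Real

lemma aux_formula (k : ℕ) (h : 0 < k) : omegaBall k = √π ^ k / Gamma ((k : ℝ) / 2 + 1) := by
  unfold omegaBall
  have : Nonempty (Fin k) := ⟨⟨0, h⟩⟩
  rw [EuclideanSpace.volume_ball]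
  have h1 : 0 < Gamma ((k : ℝ) / 2 + 1) := Gamma_pos_of_pos (by positivity)
  simp only [Fintype.card_fin, ENNReal.ofReal_one, one_pow, one_mul]
  rw [ENNReal.toReal_ofReal (by positivity)]

lemma aux_pos (k : ℕ) (h : 0 < k) : 0 < omegaBall k := by
  rw [aux_formula k h]
  have h1 : 0 < Gamma ((k : ℝ) / 2 + 1) := Gamma_pos_of_pos (by positivity)
  positivity

lemma aux_beta (s : ℝ) (hs : 0 ≤ s) :
    ∫ x in (0 : ℝ)..1, x ^ s * (1 - x) ^ s =
      Gamma (s + 1) * Gamma (s + 1) / Gamma (2 * s + 2) := by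
  have h := Complex.betaIntegral_eq_Gamma_mul_div (u := ((s + 1 : ℝ) : ℂ)) (v := ((s + 1 : ℝ) : ℂ))
    (by simp; linarith) (by simp; linarith)
  rw [← Complex.ofReal_add, Complex.Gamma_ofReal, Complex.Gamma_ofReal] at h
  have h2 : Complex.betaIntegral ((s + 1 : ℝ) : ℂ) ((s + 1 : ℝ) : ℂ) =
      ((∫ x in (0 : ℝ)..1, x ^ s * (1 - x) ^ s : ℝ) : ℂ) := by
    rw [Complex.betaIntegral, ← intervalIntegral.integral_ofReal]
    apply intervalIntegral.integral_congr
    intro x hx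
    rw [Set.uIcc_of_le zero_le_one] at hx
    have h1 : 0 ≤ 1 - x := by linarith [hx.2]
    simp only [Complex.ofReal_mul, Complex.ofReal_cpow hx.1, Complex.ofReal_cpow h1]
    push_cast
    simp
  rw [h2] at h
  have h3 : s + 1 + (s + 1) = 2 * s + 2 := by ring
  rw [h3] at h
  exact_mod_cast h

lemma aux_int (s : ℝ) (hs : 0 ≤ s) :
    ∫ x in (-1 : ℝ)..1, (1 - x ^ 2) ^ s = √π * Gamma (s + 1) / Gamma (s + 3 / 2) := by
  have h1 : ∫ x in (0 : ℝ)..1, (1 - (2 * x + (-1)) ^ 2) ^ s =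
      4 ^ s * ∫ x in (0 : ℝ)..1, x ^ s * (1 - x) ^ s := by
    rw [← intervalIntegral.integral_const_mul]
    apply intervalIntegral.integral_congr
    intro x hx
    rw [Set.uIcc_of_le zero_le_one] at hx
    have h1 : 0 ≤ 1 - x := by linarith [hx.2]
    simp only
    rw [← mul_rpow hx.1 h1, ← mul_rpow (by norm_num) (mul_nonneg hx.1 h1)]
    congr 1
    ring
  have h2 := intervalIntegral.integral_comp_mul_add (a := 0) (b := 1)
    (fun x : ℝ => (1 - x ^ 2) ^ s) (c := 2) two_ne_zero (-1)
  norm_num at h2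
  rw [aux_beta s hs] at h1
  rw [h1] at h2
  have h3 := Gamma_mul_Gamma_add_half (s + 1)
  have h4 : (2 : ℝ) ^ (1 - 2 * (s + 1)) * (2 * 4 ^ s) = 1 := by
    have e4 : (4 : ℝ) ^ s = 2 ^ (2 * s) := by
      rw [rpow_mul (by norm_num)]
      norm_num
    have e2 : (2 : ℝ) * 2 ^ (2 * s) = 2 ^ (2 * s + 1) := by
      rw [rpow_add_one (by norm_num), mul_comm]
    rw [e4, e2, ← rpow_add (by norm_num)]
    convert rpow_zero (2 : ℝ) using 2
    ring
  rw [show s + 1 + 1 / 2 = s + 3 / 2 by ring, show 2 * (s + 1) = 2 * s + 2 by ring] at h3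
  rw [show 2 * (s + 1) = 2 * s + 2 by ring] at h4
  have p1 : 0 < Gamma (s + 3 / 2) := Gamma_pos_of_pos (by positivity)
  have p2 : 0 < Gamma (2 * s + 2) := Gamma_pos_of_pos (by positivity)
  have h5 : ∫ x in (-1 : ℝ)..1, (1 - x ^ 2) ^ s =
     2 * 4 ^ s * (Gamma (s + 1) * Gamma (s + 1) / Gamma (2 * s + 2)) := by linarith
  rw [h5, ← mul_div_assoc, div_eq_div_iff p2.ne' p1.ne']
  generalize (2 : ℝ) ^ (1 - (2 * s + 2)) = w at *
  generalize (4 : ℝ) ^ s = z at *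
  linear_combination 2 * z * Gamma (s + 1) * h3 + Gamma (s + 1) * Gamma (2 * s + 2) * √π * h4

lemma aux_full (n : ℕ) (hn : 2 ≤ n) :
    ∫ ρ in (-1 : ℝ)..1, omegaBall (n - 1) * (1 - ρ ^ 2) ^ (((n : ℝ) - 1) / 2) = omegaBall n := by
  obtain ⟨m, rfl⟩ : ∃ m, n = m + 1 := ⟨n - 1, by omega⟩
  rw [intervalIntegral.integral_const_mul, aux_int]
  · rw [Nat.add_sub_cancel, aux_formula m (by omega), aux_formula (m + 1) (by omega)]
    push_cast
    rw [show ((m : ℝ) + 1 - 1) / 2 = m / 2 by ring,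
      show ((m : ℝ) + 1) / 2 + 1 = m / 2 + 3 / 2 by ring]
    have p1 : 0 < Gamma ((m : ℝ) / 2 + 3 / 2) := Gamma_pos_of_pos (by positivity)
    have p2 : 0 < Gamma ((m : ℝ) / 2 + 1) := Gamma_pos_of_pos (by positivity)
    field_simp
    ring
  · push_cast; simp; positivity

lemma aux_cont (n : ℕ) (hn : 2 ≤ n) :
    Continuous fun ρ : ℝ => (1 - ρ ^ 2) ^ (((n : ℝ) - 1) / 2) := by
  have : (2 : ℝ) ≤ n := by exact_mod_cast hn
  exact Continuous.rpow_const (by fun_prop) (fun _ => Or.inr (by linarith))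

lemma aux_ii (n : ℕ) (hn : 2 ≤ n) (τ : ℝ) (hτ : τ ∈ Set.Ioo (-1 : ℝ) 1) :
    IntervalIntegrable (fun ρ : ℝ => (1 - ρ ^ 2) ^ (((n : ℝ) - 3) / 2)) volume (-τ) 1 := by
  have hn' : (2 : ℝ) ≤ n := by exact_mod_cast hn
  have h1 : IntervalIntegrable (fun ρ : ℝ => (1 - ρ) ^ (((n : ℝ) - 3) / 2)) volume (-τ) 1 := by
    have := (intervalIntegral.intervalIntegrable_rpow' (a := 1 + τ) (b := 0)
      (r := ((n : ℝ) - 3) / 2) (by linarith)).comp_sub_left 1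
    simpa using this
  have h2 : ContinuousOn (fun ρ : ℝ => (1 + ρ) ^ (((n : ℝ) - 3) / 2)) (Set.uIcc (-τ) 1) := by
    rw [Set.uIcc_of_le (by linarith [hτ.1])]
    apply ContinuousOn.rpow_const (by fun_prop)
    intro x hx
    left
    linarith [hx.1, hτ.2]
  refine (h1.mul_continuousOn h2).congr ?_
  intro x hx
  rw [Set.uIoc_of_le (by linarith [hτ.1])] at hx
  simp only
  rw [← mul_rpow (by linarith [hx.2]) (by linarith [hx.1, hτ.2])]
  congr 1
  ring

lemma aux_div (n : ℕ) (hn : 2 ≤ n) (τ : ℝ) (hτ : τ ∈ Set.Ioo (-1 : ℝ) 1) :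
    capA n τ + τ * capA0 n τ = n * capV n τ := by
  have hn' : (2 : ℝ) ≤ n := by exact_mod_cast hn
  have hc := aux_cont n hn
  have i1 := aux_ii n hn τ hτ
  have i2 : IntervalIntegrable (fun ρ : ℝ => (1 - ρ ^ 2) ^ (((n : ℝ) - 1) / 2)) volume (-τ) 1 :=
    hc.intervalIntegrable _ _
  have key := intervalIntegral.integral_eq_sub_of_hasDerivAt_of_le (a := -τ) (b := 1)
    (f := fun ρ : ℝ => ρ * (1 - ρ ^ 2) ^ (((n : ℝ) - 1) / 2))
    (f' := fun ρ : ℝ => n * (1 - ρ ^ 2) ^ (((n : ℝ) - 1) / 2)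
      - ((n : ℝ) - 1) * (1 - ρ ^ 2) ^ (((n : ℝ) - 3) / 2))
    (by linarith [hτ.1]) (by fun_prop) ?_ ((i2.const_mul _).sub (i1.const_mul _))
  · rw [intervalIntegral.integral_sub (i2.const_mul _) (i1.const_mul _),
      intervalIntegral.integral_const_mul, intervalIntegral.integral_const_mul] at key
    unfold capA capA0 capV
    rw [intervalIntegral.integral_const_mul, intervalIntegral.integral_const_mul]
    have : (1 - (1 : ℝ) ^ 2) ^ (((n : ℝ) - 1) / 2) = 0 := by
      rw [one_pow, sub_self, zero_rpow (by linarith)]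
    simp only [this, neg_sq] at key
    linear_combination (-omegaBall (n - 1)) * key
  · intro x hx
    have hp : 0 < 1 - x ^ 2 := by nlinarith [hx.1, hx.2, hτ.1, hτ.2]
    have d1 : HasDerivAt (fun ρ : ℝ => 1 - ρ ^ 2) (-(2 * x)) x := by
      simpa using (hasDerivAt_pow 2 x).const_sub 1
    have d2 := (hasDerivAt_id x).mul (d1.rpow_const (p := ((n : ℝ) - 1) / 2) (Or.inl hp.ne'))
    refine d2.congr_deriv ?_
    rw [show ((n : ℝ) - 1) / 2 - 1 = ((n : ℝ) - 3) / 2 by ring]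
    have e : (1 - x ^ 2) ^ (((n : ℝ) - 1) / 2)
        = (1 - x ^ 2) ^ (((n : ℝ) - 3) / 2) * (1 - x ^ 2) := by
      rw [← rpow_add_one hp.ne']
      congr 1
      ring
    rw [e]
    simp only [id]
    ring

/-- For every `n ≥ 2` and `τ ∈ (-1,1)`, one has `ψ(τ) ≤ n·ωₙ^{1/n}`,
the value corresponding to the isoperimetric problem. -/
theorem psi_le_isoperimetric (n : ℕ) (hn : 2 ≤ n) (τ : ℝ) (hτ : τ ∈ Set.Ioo (-1 : ℝ) 1) :
    psiFun n τ ≤ (n : ℝ) * omegaBall n ^ (1 / (n : ℝ)) := by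
  have hn' : (2 : ℝ) ≤ n := by exact_mod_cast hn
  have hV : capV n τ ≤ omegaBall n := by
    rw [← aux_full n hn]
    unfold capV
    apply intervalIntegral.integral_mono_interval (by linarith [hτ.2]) (by linarith [hτ.1]) le_rfl
    · refine (ae_restrict_iff' measurableSet_Ioc).2 (Filter.Eventually.of_forall ?_)
      intro x hx
      have hp : 0 ≤ 1 - x ^ 2 := by nlinarith [hx.1, hx.2]
      exact mul_nonneg (aux_pos _ (by omega)).le (rpow_nonneg hp _)
    · exact ((aux_cont n hn).const_mul _).intervalIntegrable _ _
  have h0 : 0 ≤ capV n τ := by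
    unfold capV
    apply intervalIntegral.integral_nonneg (by linarith [hτ.1])
    intro x hx
    have hp : 0 ≤ 1 - x ^ 2 := by nlinarith [hx.1, hx.2, hτ.2]
    exact mul_nonneg (aux_pos _ (by omega)).le (rpow_nonneg hp _)
  unfold psiFun
  rw [aux_div n hn τ hτ]
  have hr : 0 ≤ omegaBall n ^ (1 / (n : ℝ)) := rpow_nonneg (aux_pos n (by omega)).le _
  rcases h0.eq_or_lt with h | h
  · rw [← h]
    simp only [mul_zero, zero_div]
    positivity
  · rw [mul_div_assoc]
    refine mul_le_mul_of_nonneg_left ?_ (by positivity)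
    calc capV n τ / capV n τ ^ (((n : ℝ) - 1) / n) = capV n τ ^ (1 / (n : ℝ)) := by
          nth_rewrite 1 [← rpow_one (capV n τ)]
          rw [← rpow_sub h]
          congr 1
          field_simp
          ring
      _ ≤ _ := rpow_le_rpow h0 hV (by positivity)
end

section
/- For every integer n ≥ 2 there exists a constant C > 0, depending only on n, with the following property: for every natural number N, every a : Fin N → ℝ with a_i ≥ 0 for all i and ∑_{i} a_i = 1, and every index M ∈ Fin N such that ∑_{i < M} a_i ≤ 1/2 and ∑_{i > M} a_i ≤ 1/2, one has ( ∑_{i ≠ M} a_i )^{(n−1)/n} ≤ C · ( ∑_{i} a_i^{(n−1)/n} − 1 ). -/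
open Real Finset

lemma aux_add_rpow {p x y : ℝ} (hp0 : 0 ≤ p) (hp1 : p ≤ 1) (hx : 0 ≤ x) (hy : 0 ≤ y) :
    (x + y) ^ p ≤ x ^ p + y ^ p := by
  have h := NNReal.rpow_add_le_add_rpow (⟨x, hx⟩ : NNReal) ⟨y, hy⟩ hp0 hp1
  exact_mod_cast h

lemma aux_sum_rpow {ι : Type*} {p : ℝ} (hp0 : 0 < p) (hp1 : p ≤ 1) (a : ι → ℝ)
    (ha : ∀ i, 0 ≤ a i) (s : Finset ι) : (∑ i ∈ s, a i) ^ p ≤ ∑ i ∈ s, a i ^ p := by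
  classical
  induction s using Finset.induction_on with
  | empty => simp [Real.zero_rpow hp0.ne']
  | insert i s hi ih =>
    rw [Finset.sum_insert hi, Finset.sum_insert hi]
    have := aux_add_rpow hp0.le hp1 (ha i) (Finset.sum_nonneg (fun j _ => ha j) : 0 ≤ ∑ j ∈ s, a j)
    linarith

lemma aux_le {p x t : ℝ} (hp0 : 0 < p) (hp1 : p ≤ 1) (hx : 0 ≤ x) (hxt : x ≤ t) :
    x ≤ t ^ (1 - p) * x ^ p := by
  rcases hx.eq_or_lt with rfl | h
  · simp [Real.zero_rpow hp0.ne']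
  · calc x = x ^ (1 - p) * x ^ p := by rw [← Real.rpow_add h]; simp
      _ ≤ _ := by
        have := Real.rpow_le_rpow hx hxt (by linarith : 0 ≤ 1 - p)
        gcongr

/-- For every `n ≥ 2` there is a constant `C > 0`, depending only on `n`, such that: for every
`N`, every `a : Fin N → ℝ` with `a_i ≥ 0` and `∑ a_i = 1`, and every `M : Fin N` with
`∑_{i<M} a_i ≤ 1/2` and `∑_{i>M} a_i ≤ 1/2`, one has
`(∑_{i≠M} a_i)^{(n−1)/n} ≤ C·(∑_i a_i^{(n−1)/n} − 1)`. -/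
theorem concentration_in_one_cube (n : ℕ) (hn : 2 ≤ n) :
    ∃ C > (0 : ℝ), ∀ (N : ℕ) (a : Fin N → ℝ), (∀ i, 0 ≤ a i) → (∑ i, a i = 1) →
      ∀ M : Fin N,
        (∑ i ∈ Finset.univ.filter (fun i => i < M), a i) ≤ 1 / 2 →
        (∑ i ∈ Finset.univ.filter (fun i => M < i), a i) ≤ 1 / 2 →
        (∑ i ∈ Finset.univ.filter (fun i => i ≠ M), a i) ^ (((n : ℝ) - 1) / (n : ℝ)) ≤
          C * ((∑ i, (a i) ^ (((n : ℝ) - 1) / (n : ℝ))) - 1) := by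
  have hn' : (2 : ℝ) ≤ n := by exact_mod_cast hn
  have hp0 : 0 < ((n : ℝ) - 1) / (n : ℝ) := div_pos (by linarith) (by linarith)
  have hp1 : ((n : ℝ) - 1) / (n : ℝ) < 1 := by
    rw [div_lt_one (by linarith)]; linarith
  generalize ((n : ℝ) - 1) / (n : ℝ) = p at hp0 hp1 ⊢
  have hc : 0 < 1 - (1 / 2 : ℝ) ^ (1 - p) := by
    have := Real.rpow_lt_one (by norm_num : (0 : ℝ) ≤ 1 / 2) (by norm_num)
      (by linarith : 0 < 1 - p)
    linarith
  refine ⟨1 / (1 - (1 / 2 : ℝ) ^ (1 - p)), by positivity, ?_⟩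
  intro N a ha hsum M hL hR
  have hne : ∀ f : Fin N → ℝ, ∑ i ∈ Finset.univ.filter (fun i => i ≠ M), f i =
      ∑ i ∈ Finset.univ.filter (fun i => i < M), f i +
      ∑ i ∈ Finset.univ.filter (fun i => M < i), f i := by
    intro f
    rw [← Finset.sum_union]
    · congr 1
      ext i
      simp
    · rw [Finset.disjoint_left]
      intro i hi hj
      simp only [Finset.mem_filter] at hi hj
      exact lt_asymm hi.2 hj.2
  have htot : ∀ f : Fin N → ℝ, ∑ i, f i =
      f M + (∑ i ∈ Finset.univ.filter (fun i => i < M), f i +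
      ∑ i ∈ Finset.univ.filter (fun i => M < i), f i) := by
    intro f
    rw [← hne, ← Finset.add_sum_erase _ _ (Finset.mem_univ M), Finset.filter_ne']
  have hsL := aux_sum_rpow hp0 hp1.le a ha (Finset.univ.filter (fun i => i < M))
  have hsR := aux_sum_rpow hp0 hp1.le a ha (Finset.univ.filter (fun i => M < i))
  have hL0 : 0 ≤ ∑ i ∈ Finset.univ.filter (fun i => i < M), a i :=
    Finset.sum_nonneg (fun j _ => ha j)
  have hR0 : 0 ≤ ∑ i ∈ Finset.univ.filter (fun i => M < i), a i :=
    Finset.sum_nonneg (fun j _ => ha j)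
  rw [htot] at hsum
  rw [hne, htot]
  have h1 := aux_le hp0 hp1.le hL0 hL
  have h2 := aux_le hp0 hp1.le hR0 hR
  have h3 := aux_le hp0 hp1.le (ha M) (by linarith : a M ≤ 1)
  rw [Real.one_rpow, one_mul] at h3
  have h4 := aux_add_rpow hp0.le hp1.le hL0 hR0
  rw [one_div_mul_eq_div, le_div_iff₀ hc]
  have h5 := mul_le_mul_of_nonneg_right h4 hc.le
  nlinarith
end

section
/- Let n ≥ 1 be an integer, c > 0, a < b real numbers, and let u : ℝ → ℝ be nonnegative and nonincreasing on [a,b], satisfying the integral differential inequality u(y) ≤ u(x) − c·∫ₓ^y u(s)^{(n−1)/n} ds for all a ≤ x ≤ y ≤ b. Then u(r) = 0 for every r ∈ [a,b] with r ≥ a + n·u(a)^{1/n}/c. -/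
open Real MeasureTheory

/-- Nonlinear comparison: if `u ≥ 0` is nonincreasing on `[a,b]` and satisfies the integral
differential inequality `u(y) ≤ u(x) − c·∫ₓ^y u(s)^{(n−1)/n} ds` for `a ≤ x ≤ y ≤ b`, then
`u` vanishes on `[a,b]` past the radius `a + n·u(a)^{1/n}/c`. -/
theorem vanishing_from_integral_inequality (n : ℕ) (hn : 1 ≤ n) (c : ℝ) (hc : 0 < c)
    (a b : ℝ) (hab : a < b) (u : ℝ → ℝ)
    (hnonneg : ∀ x ∈ Set.Icc a b, 0 ≤ u x)
    (hanti : AntitoneOn u (Set.Icc a b))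
    (hineq : ∀ x y : ℝ, a ≤ x → x ≤ y → y ≤ b →
      u y ≤ u x - c * ∫ s in x..y, (u s) ^ (((n : ℝ) - 1) / (n : ℝ))) :
    ∀ r ∈ Set.Icc a b, a + (n : ℝ) * (u a) ^ (1 / (n : ℝ)) / c ≤ r → u r = 0 := by
  intro r hr hra
  obtain ⟨har, hrb⟩ := hr
  by_contra hne
  have hpos : 0 < u r := lt_of_le_of_ne (hnonneg r ⟨har, hrb⟩) (Ne.symm hne)
  have hn0 : (0:ℝ) < n := by exact_mod_cast hn
  have hn1 : (1:ℝ) ≤ n := by exact_mod_cast hn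
  set α : ℝ := ((n:ℝ) - 1) / n with hα
  have hα0 : 0 ≤ α := div_nonneg (by linarith) hn0.le
  set v : ℝ → ℝ := fun x => u (max a (min x r)) with hv
  have hmem : ∀ x, max a (min x r) ∈ Set.Icc a b := fun x =>
    ⟨le_max_left _ _, max_le hab.le ((min_le_right _ _).trans hrb)⟩
  have hvanti : Antitone v := fun x y hxy =>
    hanti (hmem x) (hmem y) (max_le_max le_rfl (min_le_min hxy le_rfl))
  have hv0 : ∀ x, 0 ≤ v x := fun x => hnonneg _ (hmem x)
  have hveq : ∀ x, a ≤ x → x ≤ r → v x = u x := by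
    intro x h1 h2
    simp only [hv, min_eq_left h2, max_eq_right h1]
  have hvα : Antitone (fun x => v x ^ α) := fun x y hxy =>
    Real.rpow_le_rpow (hv0 y) (hvanti hxy) hα0
  have hint : ∀ x y, IntervalIntegrable (fun s => v s ^ α) volume x y :=
    fun x y => hvα.intervalIntegrable
  set G : ℝ → ℝ := fun x => u r - c * ∫ s in r..x, v s ^ α with hG
  have hGc : Continuous G :=
    continuous_const.sub (continuous_const.mul (intervalIntegral.continuous_primitive hint r))
  have hGpos : ∀ x, x ≤ r → u r ≤ G x := by
    intro x hx
    have : 0 ≤ ∫ s in x..r, v s ^ α :=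
      intervalIntegral.integral_nonneg hx (fun s _ => Real.rpow_nonneg (hv0 s) _)
    simp only [hG]
    rw [intervalIntegral.integral_symm]
    nlinarith
  have hGle : ∀ x, a ≤ x → x ≤ r → G x ≤ v x := by
    intro x h1 h2
    have h := hineq x r h1 h2 hrb
    have e : ∫ s in x..r, u s ^ α = ∫ s in x..r, v s ^ α := by
      apply intervalIntegral.integral_congr
      intro s hs
      rw [Set.uIcc_of_le h2] at hs
      simp only [hveq s (h1.trans hs.1) hs.2]
    rw [e] at h
    rw [hveq x h1 h2]
    simp only [hG]
    rw [intervalIntegral.integral_symm]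
    linarith
  have hGαc : Continuous (fun x => G x ^ α) := hGc.rpow_const (fun _ => Or.inr hα0)
  set H : ℝ → ℝ := fun x => u r - c * ∫ s in r..x, G s ^ α with hH
  have hHd : ∀ x, HasDerivAt H (-(c * G x ^ α)) x := by
    intro x
    have := ((hGαc.integral_hasStrictDerivAt r x).hasDerivAt.const_mul c).const_sub (u r)
    exact this
  have hHpos : ∀ x, x ≤ r → u r ≤ H x := by
    intro x hx
    have : 0 ≤ ∫ s in x..r, G s ^ α :=
      intervalIntegral.integral_nonneg hx
        (fun s hs => Real.rpow_nonneg (hpos.le.trans (hGpos s hs.2)) _)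
    simp only [hH]
    rw [intervalIntegral.integral_symm]
    nlinarith
  have hHle : ∀ x, a ≤ x → x ≤ r → H x ≤ G x := by
    intro x h1 h2
    have : ∫ s in x..r, G s ^ α ≤ ∫ s in x..r, v s ^ α :=
      intervalIntegral.integral_mono_on h2 (hGαc.intervalIntegrable _ _) (hint _ _)
        (fun s hs => Real.rpow_le_rpow (hpos.le.trans (hGpos s hs.2))
          (hGle s (h1.trans hs.1) hs.2) hα0)
    simp only [hH, hG]
    rw [intervalIntegral.integral_symm x r, intervalIntegral.integral_symm x r]
    nlinarith
  have hd : ∀ x, x ≤ r → HasDerivAt (fun x => H x ^ (1 / (n:ℝ)) + c / n * x)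
      (-(c * G x ^ α) * (1 / (n:ℝ)) * H x ^ (1 / (n:ℝ) - 1) + c / n * 1) x := by
    intro x hx
    exact ((hHd x).rpow_const (Or.inl (hpos.trans_le (hHpos x hx)).ne')).add
      ((hasDerivAt_id x).const_mul _)
  have hA : AntitoneOn (fun x => H x ^ (1 / (n:ℝ)) + c / n * x) (Set.Icc a r) := by
    apply antitoneOn_of_deriv_nonpos (convex_Icc a r)
    · exact fun x hx => (hd x hx.2).continuousAt.continuousWithinAt
    · rw [interior_Icc]
      exact fun x hx => (hd x hx.2.le).differentiableAt.differentiableWithinAt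
    · rw [interior_Icc]
      intro x hx
      rw [(hd x hx.2.le).deriv]
      have hHx := hpos.trans_le (hHpos x hx.2.le)
      have h1 : H x ^ α ≤ G x ^ α :=
        Real.rpow_le_rpow hHx.le (hHle x hx.1.le hx.2.le) hα0
      have h2 : H x ^ α * H x ^ (1 / (n:ℝ) - 1) = 1 := by
        rw [← Real.rpow_add hHx]
        have : α + (1 / (n:ℝ) - 1) = 0 := by rw [hα]; field_simp; ring
        rw [this, Real.rpow_zero]
      have h3 : 1 ≤ G x ^ α * H x ^ (1 / (n:ℝ) - 1) := by
        refine h2.symm.le.trans ?_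
        exact mul_le_mul_of_nonneg_right h1 (Real.rpow_nonneg hHx.le _)
      have h4 : 0 < c / n := div_pos hc hn0
      have h5 : -(c * G x ^ α) * (1 / (n:ℝ)) * H x ^ (1 / (n:ℝ) - 1) + c / n * 1
          = c / n * (1 - G x ^ α * H x ^ (1 / (n:ℝ) - 1)) := by ring
      rw [h5]
      exact mul_nonpos_of_nonneg_of_nonpos h4.le (by linarith)
  have hfin := hA ⟨le_rfl, har⟩ ⟨har, le_rfl⟩ har
  simp only at hfin
  have hr1 : 0 < H r ^ (1 / (n:ℝ)) := Real.rpow_pos_of_pos (hpos.trans_le (hHpos r le_rfl)) _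
  have ha1 : H a ^ (1 / (n:ℝ)) ≤ u a ^ (1 / (n:ℝ)) := by
    apply Real.rpow_le_rpow (hpos.le.trans (hHpos a har)) _ (by positivity)
    rw [← hveq a le_rfl har]
    exact (hHle a le_rfl har).trans (hGle a le_rfl har)
  have h6 : c / n * (a + (n : ℝ) * (u a) ^ (1 / (n : ℝ)) / c) ≤ c / n * r :=
    mul_le_mul_of_nonneg_left hra (div_pos hc hn0).le
  have h7 : c / n * (a + (n : ℝ) * (u a) ^ (1 / (n : ℝ)) / c)
      = c / n * a + (u a) ^ (1 / (n : ℝ)) := by field_simp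
  linarith
end
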